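/- arXiv:math/0306333 — 2 statements merged into one kernel-verified Lean document; each statement's English description precedes it below -/
import Mathlib

section
/- Let k be an algebraically closed field of characteristic zero and n ≥ 2. Let G̃ be the subgroup of the group of k-algebra automorphisms of L = k(x_1,…,x_n) generated by: the projective transformations (the image of PGL_{n+1}(k)), the involution σ with σ(x_1) = x_1^{-1} and σ(x_j) = x_j for j ≥ 2, and the involution ξ with ξ(x_1) = x_1^{-1}, ξ(x_2) = x_2·x_1^{-1}, and ξ(x_j) = x_j for j ≥ 3. Then for every commutative Noetherian ring R and every N ≥ 1, every group homomorphism G̃ → GL_N(R) is trivial. -/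
open Module in
lemma field_step {F V : Type*} [Field F] [IsAlgClosed F] [AddCommGroup V] [Module F V]
    [FiniteDimensional F V] (p : ℕ) (hp : p.Prime) (hpF : (p : F) ≠ 0) (hV : finrank F V < p)
    (a b w : End F V) (hw : Function.Injective w) (hb : Function.Injective b)
    (hap : a ^ p = 1) (hab : a * b = b * a) (haw : a * w = w * a) (hbw : b * w = w * a * b) :
    a = 1 := by
  by_contra hne
  have hab' : ∀ v, a (b v) = b (a v) := fun v => LinearMap.congr_fun hab v
  have haw' : ∀ v, a (w v) = w (a v) := fun v => LinearMap.congr_fun haw v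
  have hbw' : ∀ v, b (w v) = w (a (b v)) := fun v => LinearMap.congr_fun hbw v
  -- eigenvector of `a` in the range of `a - 1`
  let W : Submodule F V := LinearMap.range (a - 1)
  have hWa : ∀ v ∈ W, a v ∈ W := by
    rintro v ⟨u, rfl⟩
    exact ⟨a u, by simp⟩
  have hWne : Nontrivial W := by
    rw [Submodule.nontrivial_iff_ne_bot]
    intro h
    rw [LinearMap.range_eq_bot] at h
    exact hne (sub_eq_zero.1 h)
  obtain ⟨l, hl⟩ := End.exists_eigenvalue (a.restrict hWa)
  obtain ⟨⟨v, hvW⟩, hv⟩ := hl.exists_hasEigenvector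
  have hv1 : a v = l • v := by
    have := hv.apply_eq_smul
    simpa using congrArg Subtype.val this
  have hv0 : v ≠ 0 := fun h => hv.2 (Subtype.ext h)
  have hpow : ∀ (j : ℕ) (u : V), a u = l • u → (a ^ j) u = l ^ j • u := by
    intro j u hu
    induction j with
    | zero => simp
    | succ j ih => rw [pow_succ', Module.End.mul_apply, ih, map_smul, hu, smul_smul, pow_succ]
  have hlp : l ^ p = 1 := by
    have := hpow p v hv1
    rw [hap] at this
    have h2 : (1 - l ^ p) • v = 0 := by rw [sub_smul, ← this]; simp
    rcases smul_eq_zero.1 h2 with h | h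
    · exact (sub_eq_zero.1 h).symm
    · exact absurd h hv0
  have hl1 : l ≠ 1 := by
    rintro rfl
    obtain ⟨u, hu⟩ := hvW
    have h3 : (∑ i ∈ Finset.range p, a ^ i) * (a - 1) = 0 := by
      rw [geom_sum_mul, hap, sub_self]
    have h4 := LinearMap.congr_fun h3 u
    rw [Module.End.mul_apply, hu] at h4
    simp only [LinearMap.sum_apply, LinearMap.zero_apply] at h4
    rw [Finset.sum_congr rfl (fun i _ => hpow i v hv1)] at h4
    simp only [one_pow, one_smul, Finset.sum_const, Finset.card_range] at h4
    rw [← Nat.cast_smul_eq_nsmul F] at h4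
    rcases smul_eq_zero.1 h4 with h | h
    · exact hpF h
    · exact hv0 h
  -- eigenvector of `b` in the `l`-eigenspace
  let E : Submodule F V := End.eigenspace a l
  have hEb : ∀ v ∈ E, b v ∈ E := by
    intro v hv
    rw [End.mem_eigenspace_iff] at hv ⊢
    rw [hab', hv, map_smul]
  have : Nontrivial E := by
    rw [Submodule.nontrivial_iff_ne_bot]
    intro h
    have : v ∈ E := End.mem_eigenspace_iff.2 hv1
    rw [h] at this
    exact hv0 this
  obtain ⟨m, hm⟩ := End.exists_eigenvalue (b.restrict hEb)
  obtain ⟨⟨y, hyE⟩, hy⟩ := hm.exists_hasEigenvector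
  have hyb : b y = m • y := by
    have := hy.apply_eq_smul
    simpa using congrArg Subtype.val this
  have hy0 : y ≠ 0 := fun h => hy.2 (Subtype.ext h)
  have hya : a y = l • y := End.mem_eigenspace_iff.1 hyE
  have hm0 : m ≠ 0 := by
    rintro rfl
    rw [zero_smul] at hyb
    exact hy0 (hb (by simpa using hyb))
  have key : ∀ j : ℕ, a ((w ^ j) y) = l • (w ^ j) y ∧ b ((w ^ j) y) = (l ^ j * m) • (w ^ j) y ∧
      (w ^ j) y ≠ 0 := by
    intro j
    induction j with
    | zero => simp [hya, hyb, hy0]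
    | succ j ih =>
      obtain ⟨h1, h2, h3⟩ := ih
      rw [pow_succ', Module.End.mul_apply]
      refine ⟨?_, ?_, ?_⟩
      · rw [haw', h1, map_smul]
      · rw [hbw', h2, map_smul, h1, map_smul, map_smul, smul_smul]
        congr 1; ring
      · intro h
        exact h3 (hw (by simpa using h))
  have hord : orderOf l = p := by
    have := Fact.mk hp
    exact orderOf_eq_prime hlp hl1
  have hli := End.eigenvectors_linearIndependent' b (fun j : Fin p => l ^ (j : ℕ) * m)
    (by
      intro i j hij
      have h5 : l ^ (i : ℕ) = l ^ (j : ℕ) := mul_right_cancel₀ hm0 hij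
      have := pow_injOn_Iio_orderOf (x := l) (by simp [hord]) (by simp [hord]) h5
      exact Fin.ext this)
    (fun j : Fin p => (w ^ (j : ℕ)) y)
    (fun j => ⟨End.mem_eigenspace_iff.2 (key j).2.1, (key j).2.2⟩)
  have := hli.fintype_card_le_finrank
  simp at this
  omega

lemma noeth_step {G : Type} [Group G] {R : Type} [CommRing R] [IsNoetherianRing R] (N : ℕ)
    (φ : G →* (Matrix (Fin N) (Fin N) R)ˣ)
    (hperf : ∀ (H : Type) [Group H] (ψ : G →* H), (∀ g h, ψ g * ψ h = ψ h * ψ g) → ∀ g, ψ g = 1)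
    (hfld : ∀ (F : Type) [Field F] [IsAlgClosed F] (ψ : G →* (Matrix (Fin N) (Fin N) F)ˣ) (g : G),
      ψ g = 1) (g : G) : φ g = 1 := by
  have key : ∀ (m : Ideal R), m.IsMaximal → ∀ (i : ℕ) (g : G) (a b : Fin N),
      ((φ g).val - 1) a b ∈ m ^ (i + 1) := by
    intro m hm i
    have red : ∀ (S : Type) [CommRing S] (f : R →+* S) (g : G)
        (h : (Units.map (f.mapMatrix (m := Fin N)).toMonoidHom) (φ g) = 1) (a b : Fin N),
        f (((φ g).val - 1) a b) = 0 := by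
      intro S _ f g h a b
      have h1 : f.mapMatrix (φ g).val = 1 := congrArg Units.val h
      have h2 : f.mapMatrix ((φ g).val - 1) = 0 := by rw [map_sub, h1, map_one, sub_self]
      exact congrFun (congrFun h2 a) b
    induction i with
    | zero =>
      intro g a b
      let _ : Field (R ⧸ m) := Ideal.Quotient.field m
      have h := red (AlgebraicClosure (R ⧸ m))
        ((algebraMap (R ⧸ m) (AlgebraicClosure (R ⧸ m))).comp (Ideal.Quotient.mk m)) g
        (hfld _ ((Units.map _).comp φ) g) a b
      rw [RingHom.comp_apply, map_eq_zero, Ideal.Quotient.eq_zero_iff_mem] at h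
      simpa using h
    | succ i ih =>
      intro g a b
      have h := red (R ⧸ m ^ (i + 1 + 1)) (Ideal.Quotient.mk (m ^ (i + 1 + 1))) g
        (hperf _ ((Units.map _).comp φ) (by
          intro g h
          rw [← map_mul, ← map_mul]
          apply Units.ext
          ext a b
          rw [MonoidHom.comp_apply, MonoidHom.comp_apply, map_mul φ, map_mul φ]
          change Ideal.Quotient.mk (m ^ (i + 1 + 1)) (((φ g).val * (φ h).val) a b) =
            Ideal.Quotient.mk (m ^ (i + 1 + 1)) (((φ h).val * (φ g).val) a b)
          rw [Ideal.Quotient.eq]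
          have e : (φ g).val * (φ h).val - (φ h).val * (φ g).val =
            ((φ g).val - 1) * ((φ h).val - 1) - ((φ h).val - 1) * ((φ g).val - 1) := by
            noncomm_ring
          rw [← Matrix.sub_apply, e, Matrix.sub_apply]
          have hle : m ^ (i + 1) * m ^ (i + 1) ≤ m ^ (i + 1 + 1) := by
            rw [← pow_add]; exact Ideal.pow_le_pow_right (by omega)
          refine sub_mem ?_ ?_
          · rw [Matrix.mul_apply]
            exact sum_mem fun c _ => hle (Ideal.mul_mem_mul (ih _ _ _) (ih _ _ _))
          · rw [Matrix.mul_apply]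
            exact sum_mem fun c _ => hle (Ideal.mul_mem_mul (ih _ _ _) (ih _ _ _))) g) a b
      rwa [Ideal.Quotient.eq_zero_iff_mem] at h
  apply Units.ext
  rw [← sub_eq_zero]
  ext a b
  set r := ((φ g).val - 1) a b with hr
  by_contra hne
  have hr0 : r ≠ 0 := hne
  have hann : (Ideal.torsionOf R R r) ≠ ⊤ := by
    intro h
    rw [Ideal.torsionOf_eq_top_iff] at h
    exact hr0 h
  obtain ⟨m, hm, hle⟩ := Ideal.exists_le_maximal _ hann
  have hmem : r ∈ (⨅ i : ℕ, m ^ i • ⊤ : Submodule R R) := by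
    rw [Submodule.mem_iInf]
    intro i
    have := Ideal.pow_le_pow_right (I := m) (Nat.le_succ i) (key m hm i g a b)
    rw [smul_eq_mul, Ideal.mul_top]
    exact this
  obtain ⟨c, hc⟩ := (Ideal.mem_iInf_smul_pow_eq_bot_iff m r).1 hmem
  have h1 : (1 - (c : R)) ∈ m := hle (by
    rw [Ideal.mem_torsionOf_iff, sub_smul, hc, one_smul, sub_self])
  exact hm.ne_top ((Ideal.eq_top_iff_one m).2 (by simpa using add_mem h1 c.2))
open Matrix in
/-- elementary matrix as a unit -/
noncomputable def elem {ι k : Type*} [Fintype ι] [DecidableEq ι] [Field k] {i j : ι} (hij : i ≠ j) (c : k) :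
    (Matrix ι ι k)ˣ := (SpecialLinearGroup.toGL (SpecialLinearGroup.transvection hij c))

/-- diagonal matrix with a single nontrivial entry -/
noncomputable def dg {ι k : Type*} [Fintype ι] [DecidableEq ι] [Field k] (i : ι) (c : kˣ) :
    (Matrix ι ι k)ˣ :=
  ⟨Matrix.diagonal (fun l => if l = i then (c : k) else 1),
   Matrix.diagonal (fun l => if l = i then ((c⁻¹ : kˣ) : k) else 1),
   by rw [Matrix.diagonal_mul_diagonal, ← Matrix.diagonal_one]; congr 1; ext l; split_ifs <;> simp,
   by rw [Matrix.diagonal_mul_diagonal, ← Matrix.diagonal_one]; congr 1; ext l; split_ifs <;> simp⟩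

section
variable {ι k : Type*} [Fintype ι] [DecidableEq ι] [Field k]

lemma elem_val {i j : ι} (hij : i ≠ j) (c : k) : (elem hij c).val = Matrix.transvection i j c := rfl

lemma elem_add {i j : ι} (hij : i ≠ j) (c d : k) : elem hij c * elem hij d = elem hij (c + d) := by
  apply Units.ext
  simp [elem_val, Matrix.transvection_mul_transvection_same, hij]

lemma elem_comm {i j l : ι} (hij : i ≠ j) (hjl : j ≠ l) (hil : i ≠ l) (a b : k) :
    elem hij a * elem hjl b = elem hil (a * b) * (elem hjl b * elem hij a) := by
  apply Units.ext
  simp only [Units.val_mul, elem_val, Matrix.transvection]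
  simp [mul_add, add_mul, hjl.symm, hil.symm]
  abel

lemma dg_elem_left {i j : ι} (hij : i ≠ j) (z : kˣ) (a : k) :
    dg i z * elem hij a = elem hij (z * a) * dg i z := by
  apply Units.ext
  ext r s
  simp only [Units.val_mul, elem_val, dg, Matrix.transvection, mul_add, add_mul, Matrix.add_apply,
    Matrix.diagonal_mul, Matrix.mul_diagonal, Matrix.one_apply, Matrix.single_apply]
  simp only [mul_ite, ite_mul, mul_zero, zero_mul, mul_one, one_mul]
  grind

lemma dg_elem_right {i j : ι} (hij : i ≠ j) (z : kˣ) (a : k) :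
    elem hij a * dg j z = dg j z * elem hij (z * a) := by
  apply Units.ext
  ext r s
  simp only [Units.val_mul, elem_val, dg, Matrix.transvection, mul_add, add_mul, Matrix.add_apply,
    Matrix.diagonal_mul, Matrix.mul_diagonal, Matrix.one_apply, Matrix.single_apply]
  simp only [mul_ite, ite_mul, mul_zero, zero_mul, mul_one, one_mul]
  grind

lemma diag2n_eq {i j : ι} (hij : i ≠ j) (a : k) (ha : a ≠ 0) :
    elem hij a * elem hij.symm (-a⁻¹) * elem hij a =
     (Matrix.SpecialLinearGroup.toGL (Matrix.SpecialLinearGroup.diag2n hij a ha)) *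
      (elem hij 1 * elem hij.symm (-1) * elem hij 1) := by
  apply Units.ext
  simp only [Units.val_mul, elem_val]
  have : (Matrix.SpecialLinearGroup.toGL (Matrix.SpecialLinearGroup.diag2n hij a ha)).val =
    Matrix.diagonal (fun l ↦ if l = i then a else if l = j then a⁻¹ else 1) := rfl
  rw [this]
  ext r s
  simp only [Matrix.diagonal_mul, Matrix.transvection, mul_add, add_mul, Matrix.add_apply, one_mul,
    mul_one]
  simp [hij, hij.symm, Matrix.one_apply, Matrix.single_apply]
  grind

variable {H : Type*} [Group H]

lemma gl_trivial [IsAlgClosed k] [Nontrivial ι] (Φ : (Matrix ι ι k)ˣ →* H)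
    (htr : ∀ (i j : ι) (hij : i ≠ j) (c : k), Φ (elem hij c) = 1)
    (hsc : ∀ (A : (Matrix ι ι k)ˣ) (c : k), c ≠ 0 → A.val = c • 1 → Φ A = 1)
    (A : (Matrix ι ι k)ˣ) : Φ A = 1 := by
  have hSL : ∀ M : Matrix.SpecialLinearGroup ι k, Φ (Matrix.SpecialLinearGroup.toGL M) = 1 := by
    intro M
    induction M using Matrix.SpecialLinearGroup.diagonal_transvection_induction' with
    | hdiag i j hij hc =>
      have := congrArg Φ (diag2n_eq hij _ hc)
      simpa [htr] using this.symm
    | htransvec i j hij a => exact htr i j hij a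
    | hmul A B hA hB => rw [map_mul, map_mul, hA, hB, one_mul]
  have hdet : A.val.det ≠ 0 := ((Matrix.isUnit_iff_isUnit_det _).1 A.isUnit).ne_zero
  obtain ⟨c, hc⟩ := IsAlgClosed.exists_pow_nat_eq A.val.det (n := Fintype.card ι) Fintype.card_pos
  have hc0 : c ≠ 0 := by
    rintro rfl
    rw [zero_pow Fintype.card_ne_zero] at hc
    exact hdet hc.symm
  let C : (Matrix ι ι k)ˣ := ⟨c • 1, c⁻¹ • 1, by simp [hc0], by simp [hc0]⟩
  let M : Matrix.SpecialLinearGroup ι k := ⟨c⁻¹ • A.val, by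
    rw [Matrix.det_smul, ← hc, ← mul_pow, inv_mul_cancel₀ hc0, one_pow]⟩
  have hA : A = C * Matrix.SpecialLinearGroup.toGL M := by
    apply Units.ext
    change A.val = (c • (1 : Matrix ι ι k)) * (c⁻¹ • A.val)
    simp [smul_smul, hc0]
  rw [hA, map_mul, hSL, hsc C c hc0 rfl, one_mul]

lemma elem_kill (Φ : (Matrix ι ι k)ˣ →* H) (i0 : ι) (z : kˣ) (hz : (z : k) ≠ 1)
    (hD : Φ (dg i0 z) = 1) (i j : ι) (hij : i ≠ j) (c : k) : Φ (elem hij c) = 1 := by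
  have hz' : (z : k) - 1 ≠ 0 := sub_ne_zero.2 hz
  have hl : ∀ (j : ι) (h : i0 ≠ j) (c : k), Φ (elem h c) = 1 := by
    intro j h c
    have h1 := congrArg Φ (dg_elem_left h z (c / (z - 1)))
    rw [map_mul, map_mul, hD, one_mul, mul_one] at h1
    have h2 : c + c / ((z : k) - 1) = z * (c / (z - 1)) := by field_simp; ring
    rw [← h2, ← elem_add, map_mul] at h1
    exact (right_eq_mul.1 h1)
  have hr : ∀ (j : ι) (h : j ≠ i0) (c : k), Φ (elem h c) = 1 := by
    intro j h c
    have h1 := congrArg Φ (dg_elem_right h z (c / (z - 1)))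
    rw [map_mul, map_mul, hD, one_mul, mul_one] at h1
    have h2 : c + c / ((z : k) - 1) = z * (c / (z - 1)) := by field_simp; ring
    rw [← h2, ← elem_add, map_mul] at h1
    exact (right_eq_mul.1 h1)
  by_cases hi : i = i0
  · subst hi; exact hl _ _ _
  by_cases hj : j = i0
  · subst hj; exact hr _ _ _
  have := congrArg Φ (elem_comm hi (Ne.symm hj) hij c 1)
  simpa [hl, hr] using this.symm

lemma elem_perf (Φ : (Matrix ι ι k)ˣ →* H) (h3 : 2 < Fintype.card ι)
    (hcomm : ∀ A B, Φ A * Φ B = Φ B * Φ A) (i j : ι) (hij : i ≠ j) (c : k) :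
    Φ (elem hij c) = 1 := by
  obtain ⟨l, hli, hlj⟩ : ∃ l, l ≠ i ∧ l ≠ j := by
    by_contra! h
    have : (Finset.univ : Finset ι) ⊆ {i, j} := by
      intro l _
      by_cases hl : l = i
      · simp [hl]
      · simp [h l hl]
    have := (Finset.card_le_card this).trans Finset.card_le_two
    rw [Finset.card_univ] at this
    omega
  have := congrArg Φ (elem_comm hli.symm hlj hij c 1)
  rw [map_mul, map_mul, map_mul, hcomm] at this
  simpa using this.symm
end

theorem cremona_subgroup_no_finite_representations
    (k : Type) [Field k] [CharZero k] [IsAlgClosed k] (n : ℕ) (hn : 2 ≤ n)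
    (x : Fin n → FractionRing (MvPolynomial (Fin n) k))
    (hx : ∀ j, x j = algebraMap (MvPolynomial (Fin n) k) (FractionRing (MvPolynomial (Fin n) k))
      (MvPolynomial.X j))
    (den : (Matrix (Fin (n + 1)) (Fin (n + 1)) k)ˣ → FractionRing (MvPolynomial (Fin n) k))
    (hden : ∀ A, den A = (∑ i : Fin n,
        algebraMap k (FractionRing (MvPolynomial (Fin n) k)) (A.val i.castSucc (Fin.last n)) * x i)
      + algebraMap k (FractionRing (MvPolynomial (Fin n) k)) (A.val (Fin.last n) (Fin.last n)))
    (num : (Matrix (Fin (n + 1)) (Fin (n + 1)) k)ˣ → Fin n → FractionRing (MvPolynomial (Fin n) k))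
    (hnum : ∀ A j, num A j = (∑ i : Fin n,
        algebraMap k (FractionRing (MvPolynomial (Fin n) k)) (A.val i.castSucc j.castSucc) * x i)
      + algebraMap k (FractionRing (MvPolynomial (Fin n) k)) (A.val (Fin.last n) j.castSucc))
    (ρ : (Matrix (Fin (n + 1)) (Fin (n + 1)) k)ˣ →
      (FractionRing (MvPolynomial (Fin n) k) ≃ₐ[k] FractionRing (MvPolynomial (Fin n) k)))
    (hρmul : ∀ A B y, ρ (A * B) y = ρ A (ρ B y))
    (hρval : ∀ A j, ρ A (x j) * den A = num A j)
    -- the involution `s : x₁ ↦ x₁⁻¹`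
    (s : FractionRing (MvPolynomial (Fin n) k) ≃ₐ[k] FractionRing (MvPolynomial (Fin n) k))
    (hs1 : s (x ⟨0, by omega⟩) = (x ⟨0, by omega⟩)⁻¹)
    (hs2 : ∀ j : Fin n, (j : ℕ) ≠ 0 → s (x j) = x j)
    -- the involution `ξ : x₁ ↦ x₁⁻¹, x₂ ↦ x₂·x₁⁻¹`
    (ξ : FractionRing (MvPolynomial (Fin n) k) ≃ₐ[k] FractionRing (MvPolynomial (Fin n) k))
    (hξ1 : ξ (x ⟨0, by omega⟩) = (x ⟨0, by omega⟩)⁻¹)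
    (hξ2 : ξ (x ⟨1, by omega⟩) = x ⟨1, by omega⟩ * (x ⟨0, by omega⟩)⁻¹)
    (hξ3 : ∀ j : Fin n, 2 ≤ (j : ℕ) → ξ (x j) = x j)
    -- the subgroup generated by `PGL_{n+1}(k)`, `s` and `ξ`
    (Gt : Subgroup ((FractionRing (MvPolynomial (Fin n) k)) ≃ₐ[k] (FractionRing (MvPolynomial (Fin n) k))))
    (hGt : Gt = Subgroup.closure (Set.range ρ ∪ {s, ξ})) :
    ∀ (R : Type) [CommRing R] [IsNoetherianRing R] (N : ℕ), 1 ≤ N →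
      ∀ φ : Gt →* (Matrix (Fin N) (Fin N) R)ˣ, ∀ g : Gt, φ g = 1 := by
  intro R _ _ N hN φ
  have hx0 : ∀ j, x j ≠ 0 := by
    intro j
    rw [hx]
    simp
  have hext : ∀ f g : FractionRing (MvPolynomial (Fin n) k) ≃ₐ[k]
      FractionRing (MvPolynomial (Fin n) k), (∀ j, f (x j) = g (x j)) → f = g := by
    intro f g h
    have h1 : (f : FractionRing (MvPolynomial (Fin n) k) →ₐ[k] FractionRing (MvPolynomial (Fin n) k)) =
        (g : FractionRing (MvPolynomial (Fin n) k) →ₐ[k] FractionRing (MvPolynomial (Fin n) k)) := by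
      apply IsLocalization.algHom_ext (nonZeroDivisors (MvPolynomial (Fin n) k))
      apply MvPolynomial.algHom_ext
      intro j
      have := h j
      rw [hx] at this
      exact this
    ext y
    exact DFunLike.congr_fun h1 y
  have hρ1 : ∀ A B, ρ (A * B) = ρ A * ρ B := fun A B => AlgEquiv.ext (hρmul A B)
  have hmemρ : ∀ A, ρ A ∈ Gt := fun A => by
    rw [hGt]; exact Subgroup.subset_closure (Or.inl ⟨A, rfl⟩)
  have hmems : s ∈ Gt := by
    rw [hGt]; exact Subgroup.subset_closure (Or.inr (Or.inl rfl))
  have hmemξ : ξ ∈ Gt := by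
    rw [hGt]; exact Subgroup.subset_closure (Or.inr (Or.inr rfl))
  let P : (Matrix (Fin (n + 1)) (Fin (n + 1)) k)ˣ →* Gt :=
    MonoidHom.mk' (fun A => ⟨ρ A, hmemρ A⟩) (fun A B => Subtype.ext (hρ1 A B))
  have hP : ∀ A, (P A : _ ≃ₐ[k] _) = ρ A := fun A => rfl
  -- affine matrices
  have haff : ∀ A, A.val (Fin.last n) (Fin.last n) = 1 →
      (∀ i : Fin n, A.val i.castSucc (Fin.last n) = 0) → ∀ j, ρ A (x j) = num A j := by
    intro A h1 h2 j
    have hd : den A = 1 := by rw [hden]; simp [h1, h2]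
    rw [← hρval, hd, mul_one]
  have hdg : ∀ (i : Fin n) (z : kˣ) (j : Fin n), ρ (dg i.castSucc z) (x j) =
      algebraMap k _ (if j = i then (z : k) else 1) * x j := by
    intro i z j
    rw [haff, hnum]
    · simp [dg, Matrix.diagonal_apply, apply_ite (algebraMap k _), ite_mul,
        Ne.symm (Fin.castSucc_ne_last _)]
    · simp [dg, Matrix.diagonal_apply, Fin.castSucc_ne_last, Ne.symm (Fin.castSucc_ne_last _)]
    · intro l
      simp [dg, Matrix.diagonal_apply, Fin.castSucc_ne_last]
  have htl : ∀ (i : Fin n) (c : k) (j : Fin n),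
      ρ (elem (Fin.castSucc_ne_last i).symm c) (x j) =
      x j + algebraMap k _ (if j = i then c else 0) := by
    intro i c j
    rw [haff, hnum]
    · simp [elem_val, Matrix.transvection, Matrix.one_apply, Matrix.single_apply,
        apply_ite (algebraMap k _), ite_mul, eq_comm]
    · simp [elem_val, Matrix.transvection]
    · intro l
      simp [elem_val, Matrix.transvection]
  have hsw : ∀ (a b : Fin n) (j : Fin n),
      ρ (Matrix.GeneralLinearGroup.swap k a.castSucc b.castSucc) (x j) = x (Equiv.swap a b j) := by
    intro a b j
    have hval : (Matrix.GeneralLinearGroup.swap k a.castSucc b.castSucc).val =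
      Matrix.swap k a.castSucc b.castSucc := rfl
    have hsv : ∀ u v, Matrix.swap k a.castSucc b.castSucc u v =
        if Equiv.swap a.castSucc b.castSucc u = v then 1 else 0 := by
      intro u v
      simp [Matrix.swap, Equiv.Perm.permMatrix, PEquiv.toMatrix_apply, eq_comm]
    have hcs : ∀ u : Fin n, Equiv.swap a.castSucc b.castSucc u.castSucc =
        (Equiv.swap a b u).castSucc := by
      intro u
      simp only [Equiv.swap_apply_def, Fin.castSucc_inj]
      split_ifs <;> rfl
    have hla : Equiv.swap a.castSucc b.castSucc (Fin.last n) = Fin.last n :=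
      Equiv.swap_apply_of_ne_of_ne (Fin.castSucc_ne_last a).symm (Fin.castSucc_ne_last b).symm
    rw [haff, hnum]
    · have : ∀ i : Fin n, Equiv.swap a b i = j ↔ i = Equiv.swap a b j := fun i =>
        ⟨fun h => by rw [← h, Equiv.swap_apply_self], fun h => by rw [h, Equiv.swap_apply_self]⟩
      simp [hval, hsv, hcs, hla, this, apply_ite (algebraMap k _), ite_mul,
        Ne.symm (Fin.castSucc_ne_last _)]
    · rw [hval, hsv, hla, if_pos rfl]
    · intro i
      rw [hval, hsv, hcs, if_neg (Fin.castSucc_ne_last _)]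
  have hscal : ∀ (A : (Matrix (Fin (n + 1)) (Fin (n + 1)) k)ˣ) (c : k), c ≠ 0 →
      A.val = c • 1 → P A = 1 := by
    intro A c hc hA
    apply Subtype.ext
    rw [hP]
    apply hext
    intro j
    have hc' : algebraMap k (FractionRing (MvPolynomial (Fin n) k)) c ≠ 0 := by simpa using hc
    have hd : den A = algebraMap k _ c := by
      rw [hden, hA]; simp [Matrix.one_apply, Fin.castSucc_ne_last]
    have hn' : num A j = algebraMap k _ c * x j := by
      rw [hnum, hA]
      simp [Matrix.one_apply, Ne.symm (Fin.castSucc_ne_last _), apply_ite (algebraMap k _), ite_mul]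
    have := hρval A j
    rw [hd, hn', mul_comm] at this
    exact mul_left_cancel₀ hc' this
  set i0 : Fin n := ⟨0, by omega⟩ with hi0
  set i1 : Fin n := ⟨1, by omega⟩ with hi1
  have h01 : i0 ≠ i1 := by simp [hi0, hi1]
  have hs2' : ∀ j, j ≠ i0 → s (x j) = x j := fun j hj => hs2 j (fun h => hj (Fin.ext h))
  have hξ3' : ∀ j, j ≠ i0 → j ≠ i1 → ξ (x j) = x j := fun j hj hj' => hξ3 j (by
    have h1 : (j : ℕ) ≠ 0 := fun h => hj (Fin.ext h)
    have h2 : (j : ℕ) ≠ 1 := fun h => hj' (Fin.ext h)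
    omega)
  have hX1 : (1 : FractionRing (MvPolynomial (Fin n) k)) - x i0 ≠ 0 := by
    rw [hx, sub_ne_zero]
    intro h
    rw [← map_one (algebraMap (MvPolynomial (Fin n) k) _)] at h
    have h2 := IsFractionRing.injective (MvPolynomial (Fin n) k)
      (FractionRing (MvPolynomial (Fin n) k)) h
    have h3 := congrArg (MvPolynomial.eval (fun _ => (0 : k))) h2
    simp at h3
  let S : Gt := ⟨s, hmems⟩
  let Ξ : Gt := ⟨ξ, hmemξ⟩
  let T : Gt := P (dg i0.castSucc (-1) * elem (Fin.castSucc_ne_last i0).symm 1)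
  have hT : ∀ j, (T : _ ≃ₐ[k] _) (x j) = if j = i0 then 1 - x j else x j := by
    intro j
    change ρ (_ * _) (x j) = _
    rw [hρmul, htl, map_add, hdg]
    by_cases h : j = i0
    · simp [h]; ring
    · simp [h]
  have braidS : S * T * S = T * S * T := by
    apply Subtype.ext
    apply hext
    intro j
    change s ((T : _ ≃ₐ[k] _) (s (x j))) = (T : _ ≃ₐ[k] _) (s ((T : _ ≃ₐ[k] _) (x j)))
    by_cases h : j = i0
    · subst h
      have h0 := hx0 i0
      have h1' : x i0 - 1 ≠ 0 := fun h => hX1 (by rw [← neg_sub, h, neg_zero])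
      have h2' : 1 - (x i0)⁻¹ ≠ 0 := by
        intro h; apply h1'; field_simp at h; simpa using h
      rw [hs1]
      simp only [map_inv₀, hT, if_true, map_sub, map_one, hs1]
      field_simp
      ring
    · simp only [hs2' j h, hT, if_neg h]
  let W : Gt := P (Matrix.GeneralLinearGroup.swap k i0.castSucc i1.castSucc)
  have hW : ∀ j, (W : _ ≃ₐ[k] _) (x j) = x (Equiv.swap i0 i1 j) := fun j => hsw i0 i1 j
  have braidΞ : Ξ * W * Ξ = W * Ξ * W := by
    apply Subtype.ext
    apply hext
    intro j
    change ξ ((W : _ ≃ₐ[k] _) (ξ (x j))) = (W : _ ≃ₐ[k] _) (ξ ((W : _ ≃ₐ[k] _) (x j)))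
    have h0 := hx0 i0
    have h1 := hx0 i1
    by_cases h : j = i0
    · subst h
      simp only [hξ1, hξ2, map_inv₀, map_mul, hW, Equiv.swap_apply_left, Equiv.swap_apply_right]
      field_simp
    by_cases h' : j = i1
    · subst h'
      simp only [hξ1, hξ2, map_inv₀, map_mul, hW, Equiv.swap_apply_left, Equiv.swap_apply_right]
      field_simp
    · simp only [hξ3' j h h', hW, Equiv.swap_apply_of_ne_of_ne h h']
  have hkill : ∀ (H : Type) [Group H] (Ψ : Gt →* H),
      (∀ (i j : Fin (n + 1)) (hij : i ≠ j) (c : k), Ψ (P (elem hij c)) = 1) → ∀ g, Ψ g = 1 := by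
    intro H _ Ψ htr
    have : Nontrivial (Fin (n + 1)) := Fin.nontrivial_iff_two_le.2 (by omega)
    have hall : ∀ A, Ψ (P A) = 1 := gl_trivial (Ψ.comp P) htr (fun A c hc hA => by
      rw [MonoidHom.comp_apply, hscal A c hc hA, map_one])
    have hS : Ψ S = 1 := by
      have := congrArg Ψ braidS
      simpa [T, hall] using this
    have hΞ : Ψ Ξ = 1 := by
      have := congrArg Ψ braidΞ
      simpa [W, hall] using this
    have hle : Gt ≤ Ψ.ker.map Gt.subtype := by
      conv_lhs => rw [hGt]
      rw [Subgroup.closure_le]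
      rintro y (⟨A, rfl⟩ | rfl | rfl)
      · exact ⟨P A, hall A, rfl⟩
      · exact ⟨S, hS, rfl⟩
      · exact ⟨Ξ, hΞ, rfl⟩
    intro g
    obtain ⟨g', hg', h⟩ := hle g.2
    rw [← Subtype.ext h]
    exact hg'
  let M : Gt := Ξ * S
  have hM0 : (M : _ ≃ₐ[k] _) (x i0) = x i0 := by
    change ξ (s (x i0)) = _
    rw [hs1, map_inv₀, hξ1, inv_inv]
  have hM1 : (M : _ ≃ₐ[k] _) (x i1) = x i1 * (x i0)⁻¹ := by
    change ξ (s (x i1)) = _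
    rw [hs2' _ h01.symm, hξ2]
  have hMj : ∀ j, j ≠ i0 → j ≠ i1 → (M : _ ≃ₐ[k] _) (x j) = x j := by
    intro j h h'
    change ξ (s (x j)) = _
    rw [hs2' _ h, hξ3' _ h h']
  have hrel : ∀ z : kˣ, M * P (dg i0.castSucc z) =
      P (dg i1.castSucc z) * P (dg i0.castSucc z) * M := by
    intro z
    apply Subtype.ext
    apply hext
    intro j
    change (M : _ ≃ₐ[k] _) (ρ _ (x j)) = ρ _ (ρ _ ((M : _ ≃ₐ[k] _) (x j)))
    have h0 := hx0 i0
    have hz : algebraMap k (FractionRing (MvPolynomial (Fin n) k)) (z : k) ≠ 0 := by simp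
    by_cases h : j = i0
    · subst h
      simp [hdg, hM0, h01]
    by_cases h' : j = i1
    · subst h'
      simp [hdg, hM1, h01, h01.symm]
      field_simp
    · simp [hdg, hMj j h h', h, h']
  have hrelM : ∀ z : kˣ, P (dg i1.castSucc z) * M = M * P (dg i1.castSucc z) := by
    intro z
    apply Subtype.ext
    apply hext
    intro j
    change ρ _ ((M : _ ≃ₐ[k] _) (x j)) = (M : _ ≃ₐ[k] _) (ρ _ (x j))
    by_cases h : j = i0
    · subst h
      simp [hdg, hM0, h01]
    by_cases h' : j = i1
    · subst h'
      simp [hdg, hM1, h01, mul_assoc]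
    · simp [hdg, hMj j h h', h']
  have hdgc : ∀ z : kˣ, P (dg i1.castSucc z) * P (dg i0.castSucc z) =
      P (dg i0.castSucc z) * P (dg i1.castSucc z) := by
    intro z
    rw [← map_mul, ← map_mul]
    congr 1
    apply Units.ext
    simp [dg, Matrix.diagonal_mul_diagonal, mul_comm]
  refine noeth_step N φ ?_ ?_
  · intro H _ ψ hc
    exact hkill H ψ (elem_perf (ψ.comp P) (by simp; omega) (fun A B => hc _ _))
  · intro F _ _ ψ
    obtain ⟨p, hpN, hp⟩ := Nat.exists_infinite_primes (N + ringChar F + 1)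
    have hpF : (p : F) ≠ 0 := by
      intro h
      rw [ringChar.spec] at h
      rcases (Nat.dvd_prime hp).1 h with h | h
      · exact CharP.ringChar_ne_one h
      · omega
    have : NeZero (p : k) := ⟨Nat.cast_ne_zero.2 hp.ne_zero⟩
    obtain ⟨ζ, hζ⟩ := HasEnoughRootsOfUnity.exists_primitiveRoot k p
    have hζ0 : ζ ≠ 0 := hζ.ne_zero hp.ne_zero
    let z : kˣ := Units.mk0 ζ hζ0
    have hz1 : (z : k) ≠ 1 := hζ.ne_one hp.one_lt
    have hzp : z ^ p = 1 := Units.ext (by simpa [z] using hζ.pow_eq_one)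
    have hdp : (dg i1.castSucc z) ^ p = (1 : (Matrix (Fin (n + 1)) (Fin (n + 1)) k)ˣ) := by
      apply Units.ext
      rw [Units.val_pow_eq_pow_val]
      change (Matrix.diagonal _) ^ p = 1
      rw [Matrix.diagonal_pow, ← Matrix.diagonal_one]
      congr 1
      ext l
      have : (z : k) ^ p = 1 := hζ.pow_eq_one
      simp only [Pi.pow_apply]
      split_ifs <;> simp [this]
    let E : (Matrix (Fin N) (Fin N) F)ˣ →* Module.End F (Fin N → F) :=
      ((Matrix.toLinAlgEquiv' : Matrix (Fin N) (Fin N) F ≃ₐ[F] _) : _ →* _).comp (Units.coeHom _)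
    have hEinj : Function.Injective E := fun a b h =>
      Units.ext (Matrix.toLinAlgEquiv'.injective h)
    have hEu : ∀ u, Function.Injective (E u) := by
      intro u v w hvw
      have h1 : E u⁻¹ * E u = 1 := by rw [← map_mul]; simp
      have h2 : ∀ v, E u⁻¹ (E u v) = v := fun v => LinearMap.congr_fun h1 v
      rw [← h2 v, hvw, h2]
    let E' : Gt →* Module.End F (Fin N → F) := E.comp ψ
    have hA := field_step p hp hpF (by simp; omega) (E' (P (dg i1.castSucc z)))
      (E' (P (dg i0.castSucc z))) (E' M⁻¹) (hEu _) (hEu _)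
      (by rw [← map_pow, ← map_pow, hdp, map_one, map_one])
      (by rw [← map_mul E', ← map_mul E', hdgc])
      (by
        rw [← map_mul, ← map_mul]
        congr 1
        rw [eq_inv_mul_iff_mul_eq, ← mul_assoc, ← hrelM, mul_inv_cancel_right])
      (by
        rw [← map_mul, ← map_mul, ← map_mul]
        congr 1
        rw [mul_assoc, eq_inv_mul_iff_mul_eq, ← mul_assoc, hrel, mul_inv_cancel_right])
    have hψ : ψ (P (dg i1.castSucc z)) = 1 := hEinj (by rw [map_one]; exact hA)
    exact hkill _ ψ (elem_kill (ψ.comp P) i1.castSucc z hz1 hψ)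
end

section
/- Let k be a field of characteristic zero and F an algebraically closed field extension of k of countably infinite transcendence degree, and let G = Aut(F/k) be the group of field automorphisms of F fixing k pointwise. For an integer q ≥ 0, let Ω^q_{F/k} = ⋀^q_F Ω_{F/k} be the q-th exterior power over F of the module of Kähler differentials of F over k, with the semi-linear G-action induced by functoriality of Kähler differentials. Then Ω^q_{F/k} is an irreducible semi-linear G-representation: for every nonzero ω ∈ Ω^q_{F/k}, the F-linear span of the orbit {σ·ω : σ ∈ G} is all of Ω^q_{F/k}; equivalently, the only F-subspaces of Ω^q_{F/k} stable under the G-action are 0 and Ω^q_{F/k}. -/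
open scoped TensorProduct

/-- The element `a · da₁ ∧ ⋯ ∧ da_q` of the `q`-th exterior power `⋀^q_F Ω_{F/k}` of the
module of Kähler differentials. -/
noncomputable def wedgeOfDifferentials (k F : Type) [Field k] [Field F] [Algebra k F]
    (q : ℕ) (a : F) (v : Fin q → F) : ↥(⋀[F]^q (Ω[F⁄k])) :=
  ⟨a • ExteriorAlgebra.ιMulti F q (fun i => KaehlerDifferential.D k F (v i)),
    Submodule.smul_mem _ a (ExteriorAlgebra.ιMulti_range F q (Set.mem_range_self _))⟩


theorem omq_exists_aut (k F : Type) [Field k] [Field F] [Algebra k F] [IsAlgClosed F]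
    (b : ℕ → F) (hb : IsTranscendenceBasis k b)
    (e : MvPolynomial ℕ k ≃ₐ[k] MvPolynomial ℕ k) :
    ∃ σ : F ≃ₐ[k] F, ∀ i, σ (b i) = MvPolynomial.aeval b (e (MvPolynomial.X i)) := by
  have : IsAlgClosure (Algebra.adjoin k (Set.range b)) F :=
    IsAlgClosed.isAlgClosure_of_transcendence_basis b hb
  let e' : Algebra.adjoin k (Set.range b) ≃ₐ[k] Algebra.adjoin k (Set.range b) :=
    (hb.1.aevalEquiv.symm.trans e).trans hb.1.aevalEquiv
  have key := IsAlgClosure.equivOfEquiv_algebraMap F F e'.toRingEquiv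
  refine ⟨AlgEquiv.ofRingEquiv (f := IsAlgClosure.equivOfEquiv F F e'.toRingEquiv) ?_, ?_⟩
  · intro r
    have h := key (algebraMap k _ r)
    have h2 : e'.toRingEquiv (algebraMap k _ r) = algebraMap k _ r := e'.commutes r
    rw [h2] at h
    exact h
  · intro i
    have h := key (hb.1.aevalEquiv (MvPolynomial.X i))
    have h1 : algebraMap (Algebra.adjoin k (Set.range b)) F (hb.1.aevalEquiv (MvPolynomial.X i))
        = b i := by
      simp
    have h2 : e'.toRingEquiv (hb.1.aevalEquiv (MvPolynomial.X i))
        = hb.1.aevalEquiv (e (MvPolynomial.X i)) := by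
      change hb.1.aevalEquiv (e (hb.1.aevalEquiv.symm _)) = _
      rw [AlgEquiv.symm_apply_apply]
    rw [h1, h2] at h
    refine h.trans ?_
    simp

theorem omq_exists_perm (k F : Type) [Field k] [Field F] [Algebra k F] [IsAlgClosed F]
    (b : ℕ → F) (hb : IsTranscendenceBasis k b) (π : Equiv.Perm ℕ) :
    ∃ σ : F ≃ₐ[k] F, ∀ i, σ (b i) = b (π i) := by
  obtain ⟨σ, hσ⟩ := omq_exists_aut k F b hb (MvPolynomial.renameEquiv k π)
  exact ⟨σ, fun i => by rw [hσ]; simp⟩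

theorem omq_exists_affine (k F : Type) [Field k] [Field F] [Algebra k F] [IsAlgClosed F]
    (b : ℕ → F) (hb : IsTranscendenceBasis k b) (i : ℕ) (c d : k) (hc : c ≠ 0) :
    ∃ σ : F ≃ₐ[k] F, σ (b i) = c • b i + algebraMap k F d ∧ ∀ j, j ≠ i → σ (b j) = b j := by
  classical
  let f : MvPolynomial ℕ k →ₐ[k] MvPolynomial ℕ k := MvPolynomial.aeval
    (fun j => if j = i then c • MvPolynomial.X j + MvPolynomial.C d else MvPolynomial.X j)
  let g : MvPolynomial ℕ k →ₐ[k] MvPolynomial ℕ k := MvPolynomial.aeval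
    (fun j => if j = i then c⁻¹ • (MvPolynomial.X j - MvPolynomial.C d) else MvPolynomial.X j)
  have hfC : ∀ r, f (MvPolynomial.C r) = MvPolynomial.C r := fun r => f.commutes r
  have hgC : ∀ r, g (MvPolynomial.C r) = MvPolynomial.C r := fun r => g.commutes r
  have hfX : ∀ j, f (MvPolynomial.X j) =
      if j = i then c • MvPolynomial.X j + MvPolynomial.C d else MvPolynomial.X j :=
    fun j => MvPolynomial.aeval_X _ j
  have hgX : ∀ j, g (MvPolynomial.X j) =
      if j = i then c⁻¹ • (MvPolynomial.X j - MvPolynomial.C d) else MvPolynomial.X j :=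
    fun j => MvPolynomial.aeval_X _ j
  let e : MvPolynomial ℕ k ≃ₐ[k] MvPolynomial ℕ k := AlgEquiv.ofAlgHom f g
    (by
      apply MvPolynomial.algHom_ext
      intro j
      rw [AlgHom.comp_apply, hgX]
      by_cases h : j = i
      · rw [if_pos h, map_smul, map_sub, hfX, hfC, if_pos h, add_sub_cancel_right, smul_smul,
          inv_mul_cancel₀ hc, one_smul]; rfl
      · rw [if_neg h, hfX, if_neg h]; rfl)
    (by
      apply MvPolynomial.algHom_ext
      intro j
      rw [AlgHom.comp_apply, hfX]
      by_cases h : j = i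
      · rw [if_pos h, map_add, map_smul, hgX, hgC, if_pos h, smul_smul,
          mul_inv_cancel₀ hc, one_smul, sub_add_cancel]; rfl
      · rw [if_neg h, hgX, if_neg h]; rfl)
  obtain ⟨σ, hσ⟩ := omq_exists_aut k F b hb e
  have he : ∀ j, e (MvPolynomial.X j) =
      if j = i then c • MvPolynomial.X j + MvPolynomial.C d else MvPolynomial.X j := hfX
  refine ⟨σ, ?_, ?_⟩
  · rw [hσ, he, if_pos rfl]
    simp
  · intro j hj
    rw [hσ, he, if_neg hj]
    simp

theorem omq_orbit (k F : Type) [Field k] [Field F] [Algebra k F]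
    (A : Subalgebra k F) (σ : F ≃ₐ[k] F) (hA : ∀ a ∈ A, σ a = a) (y : ℕ → F)
    (hy : ∀ n, σ (y n) = y (n + 1)) (hinj : Function.Injective y) :
    ¬ IsAlgebraic A (y 0) := by
  rintro ⟨p, hp, h0⟩
  let τ : F →ₐ[A] F := { (σ : F →+* F) with commutes' := fun a => hA a.1 a.2 }
  have hroot : ∀ n, Polynomial.aeval (y n) p = 0 := by
    intro n
    induction n with
    | zero => exact h0
    | succ n ih =>
      rw [← hy n]
      have : σ (y n) = τ (y n) := rfl
      rw [this, Polynomial.aeval_algHom_apply, ih, map_zero]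
  refine Set.infinite_range_of_injective hinj ((p.rootSet_finite F).subset ?_)
  rintro _ ⟨n, rfl⟩
  exact Polynomial.mem_rootSet.2 ⟨hp, hroot n⟩

theorem omq_halg (k F : Type) [Field k] [Field F] [Algebra k F]
    (b : ℕ → F) (hb : IsTranscendenceBasis k b) (f : F) :
    Algebra.IsAlgebraic (Algebra.adjoin k (insert f (Set.range b))) F := by
  have h1 := hb.isAlgebraic
  constructor
  intro x
  obtain ⟨p, hp, hpx⟩ := h1.isAlgebraic x
  let ι := Subalgebra.inclusion (Algebra.adjoin_mono (R := k) (Set.subset_insert f (Set.range b)))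
  have hι : Function.Injective ι := Subalgebra.inclusion_injective _
  refine ⟨p.map (ι : _ →+* _), (Polynomial.map_ne_zero_iff hι).2 hp, ?_⟩
  rw [Polynomial.aeval_def, Polynomial.eval₂_map]
  exact hpx

theorem omq_hfix (k F : Type) [Field k] [Field F] [Algebra k F] (u : Set F) (σ : F ≃ₐ[k] F)
    (h : ∀ x ∈ u, σ x = x) (a : F) (ha : a ∈ Algebra.adjoin k u) : σ a = a := by
  induction ha using Algebra.adjoin_induction with
  | mem x hx => exact h x hx
  | algebraMap r => exact σ.commutes r
  | add x y _ _ hx hy => rw [map_add, hx, hy]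
  | mul x y _ _ hx hy => rw [map_mul, hx, hy]

theorem omq_hualg (k F : Type) [Field k] [Field F] [Algebra k F] (u : Set F)
    (hu : IsTranscendenceBasis k ((↑) : u → F)) (x : F) :
    IsAlgebraic (Algebra.adjoin k u) x := by
  have := hu.isAlgebraic.isAlgebraic x
  rwa [Subtype.range_coe] at this

theorem omq_algebraic (k F : Type) [Field k] [CharZero k] [Field F] [Algebra k F]
    (b : ℕ → F) (hb : IsTranscendenceBasis k b) (f : F)
    (hf : ∀ i, ∃ σ : F ≃ₐ[k] F, σ (b i) = b i + 1 ∧ (∀ j, j ≠ i → σ (b j) = b j) ∧ σ f = f) :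
    IsAlgebraic k f := by
  by_contra htr
  have htr' : Transcendental k f := htr
  have hs : AlgebraicIndepOn k id ({f} : Set F) := by
    have := (algebraicIndependent_singleton_iff (R := k) (A := F) (ι := ({f} : Set F))
      (x := fun x => x.1) ⟨f, rfl⟩).2 htr'
    exact this
  have halg := omq_halg k F b hb f
  obtain ⟨u, hfu, hut, hu⟩ := exists_isTranscendenceBasis_between (R := k) ({f} : Set F)
    (insert f (Set.range b)) (by simp) hs
  have hex : ∃ i, b i ∉ u ∨ b i = f := by
    by_contra! hcon
    have hsub : Set.range b ⊆ u := by
      rintro _ ⟨i, rfl⟩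
      exact (hcon i).1
    have hmax := ((isTranscendenceBasis_iff_maximal).1 hb.to_subtype_range)
    have hle := hmax.2 hu.1 hsub
    obtain ⟨i, hi⟩ := hle (hfu rfl)
    exact (hcon i).2 hi
  obtain ⟨i, hi⟩ := hex
  obtain ⟨σ, h1, h2, h3⟩ := hf i
  have : CharZero F := charZero_of_injective_algebraMap (algebraMap k F).injective
  by_cases hif : b i = f
  · rw [hif, h3] at h1
    simp at h1
  have hiu : b i ∉ u := hi.resolve_right hif
  have hfix : ∀ a ∈ Algebra.adjoin k u, σ a = a := by
    refine omq_hfix k F u σ fun x hx => ?_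
    rcases hut hx with h | ⟨j, h⟩
    · rw [h, h3]
    · rw [← h]
      exact h2 j (fun hji => hiu (by rw [← hji, h]; exact hx))
  refine omq_orbit k F (Algebra.adjoin k u) σ hfix (fun n => b i + n) ?_ ?_ ?_
  · intro n
    change σ (b i + (n : F)) = b i + ((n + 1 : ℕ) : F)
    rw [map_add, h1, map_natCast, Nat.cast_add, Nat.cast_one, add_assoc, add_comm 1]
  · intro m n h
    exact Nat.cast_injective (add_left_cancel h)
  · exact omq_hualg k F u hu _

theorem omq_not_scaled (k F : Type) [Field k] [CharZero k] [Field F] [Algebra k F]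
    (f : F) (hf : IsAlgebraic k f) (hf0 : f ≠ 0) (σ : F ≃ₐ[k] F) (h : σ f * 2 = f) : False := by
  have : CharZero F := charZero_of_injective_algebraMap (algebraMap k F).injective
  refine omq_orbit k F ⊥ σ ?_ (fun n => f * (2⁻¹) ^ n) ?_ ?_ ?_
  · intro a ha
    obtain ⟨r, rfl⟩ := Algebra.mem_bot.1 ha
    exact σ.commutes r
  · intro n
    have : σ f = f * 2⁻¹ := by
      rw [eq_mul_inv_iff_mul_eq₀ two_ne_zero, h]
    simp only [map_mul, map_pow, map_inv₀, this, map_ofNat]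
    ring
  · intro m n hmn
    have h1 : (2⁻¹ : F) ^ m = 2⁻¹ ^ n := mul_left_cancel₀ hf0 hmn
    rw [inv_pow, inv_pow, inv_inj] at h1
    have h2 : ((2 ^ m : ℕ) : F) = ((2 ^ n : ℕ) : F) := by push_cast; exact h1
    exact Nat.pow_right_injective le_rfl (Nat.cast_injective h2)
  · simp only [pow_zero, mul_one]
    exact hf.extendScalars (algebraMap k (⊥ : Subalgebra k F)).injective

theorem omq_basis (k F : Type) [Field k] [CharZero k] [Field F] [Algebra k F]
    (b : ℕ → F) (hb : IsTranscendenceBasis k b) :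
    ∃ B : Module.Basis ℕ F (Ω[F⁄k]), ∀ i, B i = KaehlerDifferential.D k F (b i) := by
  let : Algebra (MvPolynomial ℕ k) F := (MvPolynomial.aeval b).toAlgebra
  have hinj : Function.Injective (algebraMap (MvPolynomial ℕ k) F) := hb.1
  have : IsScalarTower k (MvPolynomial ℕ k) F := IsScalarTower.of_algebraMap_eq fun r =>
    ((MvPolynomial.aeval b).commutes r).symm
  have : FaithfulSMul (MvPolynomial ℕ k) F := (faithfulSMul_iff_algebraMap_injective _ _).2 hinj
  let : Algebra (FractionRing (MvPolynomial ℕ k)) F := FractionRing.liftAlgebra _ _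
  have : IsScalarTower (MvPolynomial ℕ k) (FractionRing (MvPolynomial ℕ k)) F :=
    FractionRing.isScalarTower_liftAlgebra _ _
  have : Algebra.IsAlgebraic (MvPolynomial ℕ k) F := by
    have h1 := hb.isAlgebraic
    constructor
    intro x
    obtain ⟨p, hp, hpx⟩ := h1.isAlgebraic x
    refine ⟨p.map (hb.1.aevalEquiv.symm : _ →+* MvPolynomial ℕ k), ?_, ?_⟩
    · exact (Polynomial.map_ne_zero_iff hb.1.aevalEquiv.symm.injective).2 hp
    · rw [Polynomial.aeval_def, Polynomial.eval₂_map]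
      rw [Polynomial.aeval_def] at hpx
      convert hpx using 2
      ext a
      obtain ⟨a, rfl⟩ := hb.1.aevalEquiv.surjective a
      simp
      rfl
  have : Algebra.IsAlgebraic (FractionRing (MvPolynomial ℕ k)) F :=
    Algebra.IsAlgebraic.extendScalars (R := MvPolynomial ℕ k) (IsFractionRing.injective _ _)
  have : CharZero (FractionRing (MvPolynomial ℕ k)) := 
    charZero_of_injective_algebraMap (R := k) (algebraMap k _).injective
  have : Algebra.FormallyEtale (FractionRing (MvPolynomial ℕ k)) F :=
    Algebra.FormallyEtale.of_isSeparable _ _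
  have : Algebra.FormallyEtale (MvPolynomial ℕ k) (FractionRing (MvPolynomial ℕ k)) :=
    Algebra.FormallyEtale.of_isLocalization (nonZeroDivisors (MvPolynomial ℕ k))
  have : Algebra.FormallyEtale (MvPolynomial ℕ k) F :=
    Algebra.FormallyEtale.comp _ (FractionRing (MvPolynomial ℕ k)) _
  refine ⟨((KaehlerDifferential.mvPolynomialBasis k ℕ).baseChange F).map
    (KaehlerDifferential.tensorKaehlerEquivOfFormallyEtale k (MvPolynomial ℕ k) F), fun i => ?_⟩
  rw [Module.Basis.map_apply, Module.Basis.baseChange_apply]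
  simp
  congr 1
  exact MvPolynomial.aeval_X b i

theorem omq_wedge_eq (k F : Type) [Field k] [Field F] [Algebra k F] (q : ℕ) (a : F)
    (v : Fin q → F) : wedgeOfDifferentials k F q a v =
      a • exteriorPower.ιMulti F q (fun i => KaehlerDifferential.D k F (v i)) := rfl

theorem omq_induction (k F : Type) [Field k] [Field F] [Algebra k F] (q : ℕ)
    (p : ↥(⋀[F]^q (Ω[F⁄k])) → Prop) (h0 : p 0) (hadd : ∀ x y, p x → p y → p (x + y))
    (hw : ∀ a v, p (wedgeOfDifferentials k F q a v)) (x : ↥(⋀[F]^q (Ω[F⁄k]))) : p x := by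
  have hspan := exteriorPower.ιMulti_span_of_span F q (M := Ω[F⁄k])
    (KaehlerDifferential.span_range_derivation k F)
  have hx : x ∈ (⊤ : Submodule F ↥(⋀[F]^q (Ω[F⁄k]))) := trivial
  rw [← hspan] at hx
  suffices h : ∀ c : F, p (c • x) by simpa using h 1
  induction hx using Submodule.span_induction with
  | mem x hx =>
    obtain ⟨a, ha, rfl⟩ := hx
    have ha' : ∀ i, ∃ v, KaehlerDifferential.D k F v = a i := fun i => ha (Set.mem_range_self i)
    choose v hv using ha'
    intro c
    have h := hw c v
    rw [omq_wedge_eq, funext hv] at h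
    exact h
  | zero => intro c; simpa using h0
  | add x y _ _ hx hy =>
    intro c
    rw [smul_add]; exact hadd _ _ (hx c) (hy c)
  | smul a x _ hx =>
    intro c
    rw [smul_smul]; exact hx _

theorem omq_semi (k F : Type) [Field k] [Field F] [Algebra k F]
    (q : ℕ)
    (W : (F ≃ₐ[k] F) → (↥(⋀[F]^q (Ω[F⁄k])) →+ ↥(⋀[F]^q (Ω[F⁄k]))))
    (hW : ∀ (σ : F ≃ₐ[k] F) (a : F) (v : Fin q → F),
      W σ (wedgeOfDifferentials k F q a v)
        = wedgeOfDifferentials k F q (σ a) (fun i => σ (v i)))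
    (σ : F ≃ₐ[k] F) (a : F) (x : ↥(⋀[F]^q (Ω[F⁄k]))) : W σ (a • x) = σ a • W σ x := by
  induction x using omq_induction with
  | h0 => simp
  | hadd x y hx hy => rw [smul_add, map_add, hx, hy, map_add, smul_add]
  | hw c v =>
    have : a • wedgeOfDifferentials k F q c v = wedgeOfDifferentials k F q (a * c) v := by
      rw [omq_wedge_eq, omq_wedge_eq, smul_smul]
    rw [this, hW, hW, omq_wedge_eq, omq_wedge_eq, smul_smul, map_mul]

theorem omq_main (k F : Type) [Field k] [CharZero k] [Field F] [Algebra k F] [IsAlgClosed F]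
    (b : ℕ → F) (hb : IsTranscendenceBasis k b)
    (q : ℕ)
    (W : (F ≃ₐ[k] F) → (↥(⋀[F]^q (Ω[F⁄k])) →+ ↥(⋀[F]^q (Ω[F⁄k]))))
    (hW : ∀ (σ : F ≃ₐ[k] F) (a : F) (v : Fin q → F),
      W σ (wedgeOfDifferentials k F q a v)
        = wedgeOfDifferentials k F q (σ a) (fun i => σ (v i)))
    (V : Submodule F ↥(⋀[F]^q (Ω[F⁄k])))
    (hV : ∀ (σ : F ≃ₐ[k] F), ∀ w ∈ V, W σ w ∈ V)
    (hne : ∃ w ∈ V, w ≠ 0) : V = ⊤ := by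
  classical
  obtain ⟨B, hB⟩ := omq_basis k F b hb
  let E := B.exteriorPower q
  have hE : ∀ s, E s = wedgeOfDifferentials k F q 1
      (fun i => b (Set.powersetCard.ofFinEmbEquiv.symm s i)) := by
    intro s
    rw [omq_wedge_eq, one_smul]
    simp only [E, exteriorPower.basis_apply, exteriorPower.ιMulti_family]
    congr 1
    funext i
    exact hB _
  have hsemi : ∀ σ (a : F) x, W σ (a • x) = σ a • W σ x := omq_semi k F q W hW
  -- minimal support
  let P : ℕ → Prop := fun n => ∃ w ∈ V, w ≠ 0 ∧ (E.repr w).support.card = n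
  have hP : ∃ n, P n := by
    obtain ⟨w, hw, h0⟩ := hne
    exact ⟨_, w, hw, h0, rfl⟩
  obtain ⟨w, hw, hw0, hcard⟩ := Nat.find_spec hP
  have hmin : ∀ x ∈ V, (E.repr x).support.card < (E.repr w).support.card → x = 0 := by
    intro x hx hlt
    by_contra hx0
    rw [hcard] at hlt
    exact Nat.find_min hP hlt ⟨x, hx, hx0, rfl⟩
  have hr0 : E.repr w ≠ 0 := by simpa using hw0
  obtain ⟨s0, hs0⟩ := Finsupp.support_nonempty_iff.2 hr0
  have hs0' : E.repr w s0 ≠ 0 := Finsupp.mem_support_iff.1 hs0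
  set c0 := E.repr w s0 with hc0
  -- normalise
  let ω := c0⁻¹ • w
  have hωV : ω ∈ V := V.smul_mem _ hw
  have hω1 : E.repr ω s0 = 1 := by
    simp only [ω, map_smul, Finsupp.smul_apply, smul_eq_mul]
    exact inv_mul_cancel₀ hs0'
  have hsupp : (E.repr ω).support = (E.repr w).support := by
    simp only [ω, map_smul]
    exact Finsupp.support_smul_eq (inv_ne_zero hs0')
  clear_value ω
  -- diagonal automorphisms
  have hdiag : ∀ (σ : F ≃ₐ[k] F) (χ : Set.powersetCard ℕ q → F),
      (∀ s, W σ (E s) = χ s • E s) → ∀ s, σ (E.repr ω s) * χ s = χ s0 * E.repr ω s := by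
    intro σ χ hχ
    have hrepr : ∀ x s, E.repr (W σ x) s = σ (E.repr x s) * χ s := by
      intro x s
      have hx : x ∈ Submodule.span F (Set.range E) := by rw [E.span_eq]; trivial
      induction hx using Submodule.span_induction with
      | mem x hx =>
        obtain ⟨t, rfl⟩ := hx
        rw [hχ, map_smul, Finsupp.smul_apply, E.repr_self]
        by_cases h : s = t
        · subst h; simp
        · simp [Finsupp.single_eq_of_ne h]
      | zero => simp
      | add x y _ _ hx hy => simp [hx, hy, add_mul]
      | smul a x _ hx =>
        rw [hsemi, map_smul, map_smul, Finsupp.smul_apply, Finsupp.smul_apply, hx, smul_eq_mul,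
          smul_eq_mul, map_mul, mul_assoc]
    have hz : W σ ω - χ s0 • ω = 0 := by
      apply hmin _ (V.sub_mem (hV σ _ hωV) (V.smul_mem _ hωV))
      rw [← hsupp]
      apply Finset.card_lt_card
      refine (Finset.ssubset_iff_of_subset ?_).2 ⟨s0, ?_, ?_⟩
      · intro s hs
        rw [Finsupp.mem_support_iff] at hs ⊢
        intro h
        apply hs
        rw [map_sub, map_smul, Finsupp.sub_apply, Finsupp.smul_apply, hrepr, h]
        simp
      · rw [Finsupp.mem_support_iff, hω1]; exact one_ne_zero
      · rw [Finsupp.notMem_support_iff, map_sub, map_smul, Finsupp.sub_apply, Finsupp.smul_apply,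
          hrepr, hω1]
        simp
    intro s
    have := congrArg (fun x => E.repr x s) hz
    simp only [map_sub, map_smul, Finsupp.sub_apply, Finsupp.smul_apply, hrepr, map_zero,
      Finsupp.zero_apply, smul_eq_mul] at this
    exact sub_eq_zero.1 this
  have haff : ∀ (i : ℕ) (c d : k) (σ : F ≃ₐ[k] F), σ (b i) = c • b i + algebraMap k F d →
      (∀ j, j ≠ i → σ (b j) = b j) → ∀ s : Set.powersetCard ℕ q,
      W σ (E s) = (if i ∈ s.1 then algebraMap k F c else 1) • E s := by
    intro i c d σ h1 h2 s
    have hD : ∀ j, KaehlerDifferential.D k F (σ (b j)) =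
        (if j = i then algebraMap k F c else 1) • KaehlerDifferential.D k F (b j) := by
      intro j
      by_cases h : j = i
      · subst h
        rw [if_pos rfl, h1, map_add, Derivation.map_algebraMap, add_zero, Derivation.map_smul,
          algebraMap_smul]
      · rw [if_neg h, h2 j h, one_smul]
    rw [hE, hW, omq_wedge_eq, omq_wedge_eq]
    simp only [hD]
    rw [map_one, one_smul, one_smul, AlternatingMap.map_smul_univ]
    congr 1
    by_cases hi : i ∈ s.1
    · rw [if_pos hi]
      obtain ⟨l, hl⟩ := (Set.powersetCard.mem_range_ofFinEmbEquiv_symm_iff_mem s i).2 hi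
      rw [Finset.prod_eq_single l]
      · rw [if_pos hl]
      · intro m _ hm
        rw [if_neg]
        intro h
        exact hm ((Set.powersetCard.ofFinEmbEquiv.symm s).injective (h.trans hl.symm))
      · simp
    · rw [if_neg hi]
      apply Finset.prod_eq_one
      intro l _
      rw [if_neg]
      intro h
      exact hi ((Set.powersetCard.mem_range_ofFinEmbEquiv_symm_iff_mem s i).1 ⟨l, h⟩)
  have hsingle : ∀ s, s ≠ s0 → E.repr ω s = 0 := by
    intro s hs
    by_contra hf0
    have hfalg : IsAlgebraic k (E.repr ω s) := by
      apply omq_algebraic k F b hb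
      intro i
      obtain ⟨σ, h1, h2⟩ := omq_exists_affine k F b hb i 1 1 one_ne_zero
      refine ⟨σ, by simpa using h1, h2, ?_⟩
      have := hdiag σ _ (haff i 1 1 σ h1 h2) s
      simpa using this
    obtain ⟨i, his, hi0⟩ := (Set.powersetCard.exists_mem_notMem_iff_ne s s0).mp hs
    obtain ⟨σ, h1, h2⟩ := omq_exists_affine k F b hb i 2 0 two_ne_zero
    have := hdiag σ _ (haff i 2 0 σ h1 h2) s
    have his' : i ∈ s.1 := his
    have hi0' : i ∉ s0.1 := hi0
    rw [if_pos his', if_neg hi0', one_mul, map_ofNat] at this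
    exact omq_not_scaled k F _ hfalg hf0 σ this
  have hωE : ω = E s0 := by
    apply E.repr.injective
    ext s
    by_cases h : s = s0
    · rw [h, hω1]; simp
    · rw [hsingle s h, E.repr_self, Finsupp.single_eq_of_ne h]
  rw [hωE] at hωV
  rw [eq_top_iff, ← E.span_eq, Submodule.span_le]
  rintro _ ⟨t, rfl⟩
  have hπ : ∃ π : Equiv.Perm ℕ, ∀ l, π (Set.powersetCard.ofFinEmbEquiv.symm s0 l) =
      Set.powersetCard.ofFinEmbEquiv.symm t l := by
    have hm : MulAction.IsMultiplyPretransitive (Equiv.Perm ℕ) ℕ q :=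
      Equiv.Perm.isMultiplyPretransitive ℕ q
    obtain ⟨π, hπ⟩ := MulAction.exists_smul_eq (Equiv.Perm ℕ)
      (Set.powersetCard.ofFinEmbEquiv.symm s0).toEmbedding
      (Set.powersetCard.ofFinEmbEquiv.symm t).toEmbedding
    exact ⟨π, fun l => DFunLike.congr_fun hπ l⟩
  obtain ⟨π, hπ⟩ := hπ
  obtain ⟨σ, hσ⟩ := omq_exists_perm k F b hb π
  have := hV σ _ hωV
  rw [hE, hW] at this
  simp only [hσ, hπ, map_one] at this
  rw [← hE] at this
  exact this

/-- **Irreducibility of `Ω^q_{F/k}` as a semi-linear representation of `Aut(F/k)`.**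
Let `k` be a field of characteristic zero and `F` an algebraically closed extension of `k`
of countably infinite transcendence degree.  Let `W` encode the semi-linear action of
`G = Aut(F/k)` on `Ω^q_{F/k} = ⋀^q_F Ω_{F/k}`, determined by
`σ(a·da₁∧⋯∧da_q) = σ(a)·dσ(a₁)∧⋯∧dσ(a_q)`.  Then for every nonzero `ω` the `F`-span of
the `G`-orbit of `ω` is everything; equivalently, the only `G`-stable `F`-subspaces of
`Ω^q_{F/k}` are `0` and the whole space. -/
theorem omega_q_irreducible
    (k F : Type) [Field k] [CharZero k] [Field F] [Algebra k F] [IsAlgClosed F]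
    (b : ℕ → F) (hb : IsTranscendenceBasis k b)
    (q : ℕ)
    (W : (F ≃ₐ[k] F) → (↥(⋀[F]^q (Ω[F⁄k])) →+ ↥(⋀[F]^q (Ω[F⁄k]))))
    (hW : ∀ (σ : F ≃ₐ[k] F) (a : F) (v : Fin q → F),
      W σ (wedgeOfDifferentials k F q a v)
        = wedgeOfDifferentials k F q (σ a) (fun i => σ (v i))) :
    (∀ ω : ↥(⋀[F]^q (Ω[F⁄k])), ω ≠ 0 →
      Submodule.span F {w | ∃ σ : F ≃ₐ[k] F, w = W σ ω} = ⊤) ∧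
    (∀ V : Submodule F ↥(⋀[F]^q (Ω[F⁄k])),
      (∀ (σ : F ≃ₐ[k] F), ∀ w ∈ V, W σ w ∈ V) → V = ⊥ ∨ V = ⊤) := by
  have hcomp : ∀ σ τ x, W σ (W τ x) = W (τ.trans σ) x := by
    intro σ τ x
    induction x using omq_induction with
    | h0 => simp
    | hadd x y hx hy => simp only [map_add, hx, hy]
    | hw c v =>
      rw [hW, hW, hW]
      rfl
  have hsemi : ∀ σ (a : F) x, W σ (a • x) = σ a • W σ x := omq_semi k F q W hW
  refine ⟨fun ω hω => ?_, fun V hV => ?_⟩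
  · apply omq_main k F b hb q W hW
    · intro σ w hw
      induction hw using Submodule.span_induction with
      | mem x hx =>
        obtain ⟨τ, rfl⟩ := hx
        exact Submodule.subset_span ⟨τ.trans σ, hcomp σ τ ω⟩
      | zero => rw [map_zero]; exact Submodule.zero_mem _
      | add x y _ _ hx hy => rw [map_add]; exact Submodule.add_mem _ hx hy
      | smul a x _ hx => rw [hsemi]; exact Submodule.smul_mem _ _ hx
    · refine ⟨W AlgEquiv.refl ω, Submodule.subset_span ⟨AlgEquiv.refl, rfl⟩, ?_⟩
      have hid : ∀ x, W AlgEquiv.refl x = x := by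
        intro x
        induction x using omq_induction with
        | h0 => simp
        | hadd x y hx hy => rw [map_add, hx, hy]
        | hw c v => rw [hW]; rfl
      rwa [hid]
  · rcases eq_or_ne V ⊥ with h | h
    · exact Or.inl h
    · exact Or.inr (omq_main k F b hb q W hW V hV ((Submodule.ne_bot_iff V).1 h))
end
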